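/- Let ε > 0 and let u₁, u₂ ∈ C¹([0,T]×[0,∞)) ∩ C³ in x be two solutions of ∂ₜu + ∂ₓ[f(u)] + ε²∂ₓₓₓu = 0 on (0,T)×(0,∞) with the same initial data and the same Dirichlet boundary value at x=0, satisfying ∫₀^T (‖∂ₓu₁‖_{L^∞} + ‖∂ₓu₂‖_{L^∞}) dt < ∞ and u₁(t,·)-u₂(t,·) ∈ H²(0,∞) for a.e. t, with f ∈ C³ having bounded derivatives. Then u₁ ≡ u₂. -/

import Mathlib

open Set MeasureTheory

noncomputable def expTail (M : ℝ) (g : ℝ → ℝ) (y : ℝ) : ℝ :=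
  ∫ x in y..M, Real.exp (y - x) * g x

theorem expTail_eq (M : ℝ) (g : ℝ → ℝ) (y : ℝ) :
    expTail M g y = Real.exp y * ∫ x in y..M, Real.exp (-x) * g x := by
  unfold expTail
  rw [← intervalIntegral.integral_const_mul]
  congr 1
  ext x
  rw [sub_eq_add_neg, Real.exp_add, mul_assoc]

theorem hasDerivAt_expTail {g : ℝ → ℝ} (hg : Continuous g) (M y : ℝ) :
    HasDerivAt (expTail M g) (expTail M g y - g y) y := by
  have hc : Continuous fun x => Real.exp (-x) * g x := by fun_prop
  have h := (Real.hasDerivAt_exp y).mul (intervalIntegral.integral_hasDerivAt_left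
    (hc.intervalIntegrable y M) hc.stronglyMeasurable.stronglyMeasurableAtFilter hc.continuousAt)
  refine (h.congr_deriv ?_).congr_of_eventuallyEq (.of_forall fun z => expTail_eq M g z)
  rw [expTail_eq, mul_neg, ← mul_assoc, ← Real.exp_add]
  simp
  ring

theorem continuous_expTail {g : ℝ → ℝ} (hg : Continuous g) (M : ℝ) :
    Continuous (expTail M g) :=
  continuous_iff_continuousAt.2 fun y => (hasDerivAt_expTail hg M y).continuousAt

theorem expTail_self (M : ℝ) (g : ℝ → ℝ) : expTail M g M = 0 := by simp [expTail]

theorem expTail_add {g h : ℝ → ℝ} (hg : Continuous g) (hh : Continuous h) (M y : ℝ) :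
    expTail M (fun x => g x + h x) y = expTail M g y + expTail M h y := by
  unfold expTail
  rw [← intervalIntegral.integral_add (Continuous.intervalIntegrable (by fun_prop) _ _)
    (Continuous.intervalIntegrable (by fun_prop) _ _)]
  simp only [mul_add]

theorem expTail_const_mul (c : ℝ) (g : ℝ → ℝ) (M y : ℝ) :
    expTail M (fun x => c * g x) y = c * expTail M g y := by
  unfold expTail
  rw [← intervalIntegral.integral_const_mul]
  congr 1
  ext x
  ring

theorem expTail_mono {M y : ℝ} (hyM : y ∈ Icc 0 M) {g h : ℝ → ℝ} (hg : Continuous g)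
    (hh : Continuous h) (hgh : ∀ x ∈ Ioo 0 M, g x ≤ h x) : expTail M g y ≤ expTail M h y := by
  refine intervalIntegral.integral_mono_on_of_le_Ioo hyM.2
    (Continuous.intervalIntegrable (by fun_prop) _ _)
    (Continuous.intervalIntegrable (by fun_prop) _ _) fun x hx => ?_
  exact mul_le_mul_of_nonneg_left (hgh x ⟨hyM.1.trans_lt hx.1, hx.2⟩) (Real.exp_pos _).le

theorem abs_expTail_le {M y : ℝ} (hyM : y ∈ Icc 0 M) {g h : ℝ → ℝ} (hg : Continuous g)
    (hh : Continuous h) (hgh : ∀ x ∈ Ioo 0 M, |g x| ≤ h x) : |expTail M g y| ≤ expTail M h y := by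
  refine abs_le.2 ⟨?_, expTail_mono hyM hg hh fun x hx => (abs_le.1 (hgh x hx)).2⟩
  have := expTail_mono hyM (g := fun x => (-1) * h x) (by fun_prop) hg
    fun x hx => by linarith [(abs_le.1 (hgh x hx)).1]
  rw [expTail_const_mul] at this
  linarith

/-- If `Θ' = Θ + g` and `Θ M = 0` then `Θ` is minus the exponential tail of `g`. -/
theorem expTail_eq_neg {M y : ℝ} (hyM : y ∈ Icc 0 M) {g Θ : ℝ → ℝ} (hg : Continuous g)
    (hΘ : Continuous Θ) (hd : ∀ x ∈ Ioo 0 M, HasDerivAt Θ (Θ x + g x) x) (hM : Θ M = 0) :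
    expTail M g y = -Θ y := by
  have h := intervalIntegral.integral_eq_sub_of_hasDerivAt_of_le hyM.2
    (f := fun x => Real.exp (-x) * Θ x) (f' := fun x => Real.exp (-x) * g x)
    (by fun_prop) (fun x hx => by
      have h1 := ((hasDerivAt_neg x).exp).mul (hd x ⟨hyM.1.trans_lt hx.1, hx.2⟩)
      refine h1.congr_deriv ?_
      ring) (Continuous.intervalIntegrable (by fun_prop) _ _)
  rw [expTail_eq, h, hM, mul_zero, zero_sub, mul_neg, ← mul_assoc, ← Real.exp_add]
  simp

theorem expTail_le_of_antitone {M y : ℝ} (hyM : y ∈ Icc 0 M) {h : ℝ → ℝ} (hh : Antitone h)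
    (h0 : 0 ≤ h y) (hc : Continuous h) : expTail M h y ≤ h y := by
  have h1 : expTail M h y ≤ ∫ x in y..M, Real.exp (y - x) * h y := by
    refine intervalIntegral.integral_mono_on hyM.2
      (Continuous.intervalIntegrable (by fun_prop) _ _)
      (Continuous.intervalIntegrable (by fun_prop) _ _) fun x hx => ?_
    exact mul_le_mul_of_nonneg_left (hh hx.1) (Real.exp_pos _).le
  have h2 : ∫ x in y..M, Real.exp (y - x) * h y = (1 - Real.exp (y - M)) * h y := by
    rw [intervalIntegral.integral_mul_const, intervalIntegral.integral_comp_sub_left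
      (fun x => Real.exp x), integral_exp]
    simp
  nlinarith [Real.exp_pos (y - M)]

/-- The spatial energy estimate at a fixed time. -/
theorem energy_estimate {κ A b l M : ℝ} (hκ : 0 < κ) (hb : 0 ≤ b) (hl0 : 0 ≤ l)
    (hl1 : l ≤ 1) (hM : 0 ≤ M) {w w1 w2 w3 a a1 wt s0 s1 s2 s3 H : ℝ → ℝ}
    (cw : Continuous w) (cw1 : Continuous w1) (cw2 : Continuous w2)
    (ca : Continuous a) (ca1 : Continuous a1) (cwt : Continuous wt)
    (cs0 : Continuous s0) (cs1 : Continuous s1) (cs2 : Continuous s2) (cs3 : Continuous s3)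
    (cH : Continuous H) (hH : Antitone H) (hH0 : ∀ x, 0 ≤ H x)
    (dw : ∀ x ∈ Ioo 0 M, HasDerivAt w (w1 x) x)
    (dw1 : ∀ x ∈ Ioo 0 M, HasDerivAt w1 (w2 x) x)
    (dw2 : ∀ x ∈ Ioo 0 M, HasDerivAt w2 (w3 x) x)
    (da : ∀ x ∈ Ioo 0 M, HasDerivAt a (a1 x) x)
    (ds0 : ∀ x, HasDerivAt s0 (s1 x) x) (ds1 : ∀ x, HasDerivAt s1 (s2 x) x)
    (ds2 : ∀ x, HasDerivAt s2 (s3 x) x)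
    (hs0 : s0 M = 0) (hs1 : s1 M = 0) (hs2 : s2 M = 0) (hw0 : w 0 = 0)
    (heq : ∀ x ∈ Ioo 0 M, wt x + (a1 x * w x + a x * w1 x) + κ * w3 x = 0)
    (hw : ∀ x ∈ Ioo 0 M, |w x| ≤ b * x) (hw1 : ∀ x ∈ Ioo 0 M, |w1 x| ≤ b)
    (ha : ∀ x ∈ Ioo 0 M, |a x| ≤ A) (ha1 : ∀ x ∈ Ioo 0 M, |a1 x| ≤ A * b)
    (hH1 : ∀ x ∈ Ioo 0 M, |s1 x| ≤ H x)
    (hHr : ∀ x ∈ Ioo 0 M, |s1 x + l * s0 x| * x ≤ H x)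
    (hH3 : ∀ x ∈ Ioo 0 M, |s3 x| * x ≤ H x) (hA : 0 ≤ A) :
    ∫ y in 0..M, (1 - Real.exp (-y)) * (2 * expTail M (fun x => s0 x * w x) y *
        expTail M (fun x => s0 x * wt x) y) ≤
      ((κ + A) + 2 * (κ + A) ^ 2 / κ + 7 * A + 1) * (1 + b) *
        (∫ y in 0..M, (1 - Real.exp (-y)) * expTail M (fun x => s0 x * w x) y ^ 2)
      + b * (A + 7 * κ) ^ 2 * ∫ y in 0..M, H y ^ 2 := by
  set p := expTail M (fun x => s0 x * w x) with hp
  set pt := expTail M (fun x => s0 x * wt x) with hpt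
  set z := expTail M (fun x => a1 x * p x) with hz
  set Z := expTail M (fun x => |p x|) with hZ
  set k : ℝ → ℝ := fun x => (s1 x + l * s0 x) * (a x * w x) + 3 * κ * (s1 x * w1 x)
    + κ * (s3 x * w x) with hk
  have cp : Continuous p := continuous_expTail (by fun_prop) M
  have cpt : Continuous pt := continuous_expTail (by fun_prop) M
  have cz : Continuous z := continuous_expTail (by fun_prop) M
  have cZ : Continuous Z := continuous_expTail (by fun_prop) M
  have ck : Continuous k := by fun_prop
  set p1 : ℝ → ℝ := fun x => p x - s0 x * w x with hp1
  set p2 : ℝ → ℝ := fun x => p1 x - (s1 x * w x + s0 x * w1 x) with hp2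
  set p3 : ℝ → ℝ := fun x => p2 x - (s2 x * w x + 2 * (s1 x * w1 x) + s0 x * w2 x) with hp3
  have cp1 : Continuous p1 := by fun_prop
  have cp2 : Continuous p2 := by fun_prop
  have dp : ∀ x, HasDerivAt p (p1 x) x := fun x => hasDerivAt_expTail (by fun_prop) M x
  have dp1 : ∀ x ∈ Ioo 0 M, HasDerivAt p1 (p2 x) x := fun x hx =>
    (dp x).sub ((ds0 x).mul (dw x hx))
  have dp2 : ∀ x ∈ Ioo 0 M, HasDerivAt p2 (p3 x) x := fun x hx =>
    ((dp1 x hx).sub (((ds1 x).mul (dw x hx)).add ((ds0 x).mul (dw1 x hx)))).congr_deriv (by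
      simp only [hp3]; ring)
  have dZ : ∀ x, HasDerivAt Z (Z x - |p x|) x := fun x => hasDerivAt_expTail (by fun_prop) M x
  have pM : p M = 0 := expTail_self _ _
  have ZM : Z M = 0 := expTail_self _ _
  have p1M : p1 M = 0 := by simp [hp1, pM, hs0]
  -- the tail of the transport term
  have hq : ∀ y ∈ Icc 0 M, expTail M (fun x => a x * (s0 x * w x)) y = a y * p y + z y := by
    intro y hy
    have h := expTail_eq_neg hy (Θ := fun x => a x * p x)
      (g := fun x => a1 x * p x + (-1) * (a x * (s0 x * w x))) (by fun_prop) (by fun_prop)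
      (fun x hx => ((da x hx).mul (dp x)).congr_deriv (by simp only [hp1]; ring))
      (by simp [pM])
    rw [expTail_add (by fun_prop) (by fun_prop), expTail_const_mul] at h
    linarith
  -- the evolution equation satisfied by the tail
  have hev : ∀ y ∈ Icc 0 M, pt y = -κ * p3 y - a y * p1 y - l * (a y * p y) - (1 + l) * z y
      + (expTail M k y - 3 * κ * (s1 y * w1 y)) := by
    intro y hy
    have h := expTail_eq_neg hy
      (Θ := fun x => -(a x * (s0 x * w x)) - κ * ((s2 x * w x + 2 * (s1 x * w1 x) + s0 x * w2 x)
        + (s1 x * w x + s0 x * w1 x) + s0 x * w x) + 3 * κ * (s1 x * w1 x))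
      (g := fun x => s0 x * wt x + ((1 + l) * (a x * (s0 x * w x)) +
        (κ * (s0 x * w x) + (-1) * k x))) (by fun_prop) (by fun_prop)
      (fun x hx => by
        have d0 := (ds0 x).mul (dw x hx)
        have d1 := ((ds1 x).mul (dw x hx)).add ((ds0 x).mul (dw1 x hx))
        have d2 := (((ds2 x).mul (dw x hx)).add (((ds1 x).mul (dw1 x hx)).const_mul 2)).add
          ((ds0 x).mul (dw2 x hx))
        refine ((((da x hx).mul d0).neg.sub (((d2.add d1).add d0).const_mul κ)).add
          (((ds1 x).mul (dw1 x hx)).const_mul (3 * κ))).congr_deriv ?_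
        have e : wt x = -(a1 x * w x + a x * w1 x) - κ * w3 x := by linarith [heq x hx]
        simp only [hk, e, Pi.mul_apply]
        ring)
      (by simp [hs0, hs1, hs2])
    rw [expTail_add (by fun_prop) (by fun_prop), expTail_add (by fun_prop) (by fun_prop),
      expTail_add (by fun_prop) (by fun_prop), expTail_const_mul, expTail_const_mul,
      expTail_const_mul, hq y hy] at h
    simp only [hp3, hp2, hp1]
    linear_combination h
  have hz' : ∀ y ∈ Icc 0 M, |z y| ≤ A * b * Z y := by
    intro y hy
    rw [hZ, ← expTail_const_mul]
    refine abs_expTail_le hy (by fun_prop) (by fun_prop) fun x hx => ?_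
    rw [abs_mul]
    exact mul_le_mul_of_nonneg_right (ha1 x hx) (abs_nonneg _)
  have hk' : ∀ y ∈ Ioo 0 M, |expTail M k y - 3 * κ * (s1 y * w1 y)| ≤
      b * ((A + 7 * κ) * H y) := by
    intro y hy
    have h1 : |expTail M k y| ≤ b * (A + 4 * κ) * H y := by
      refine (abs_expTail_le (h := fun x => b * (A + 4 * κ) * H x) (Ioo_subset_Icc_self hy) ck
        (by fun_prop) fun x hx => ?_).trans ?_
      · have e1 : |(s1 x + l * s0 x) * (a x * w x)| ≤ A * b * H x := by
          rw [abs_mul, abs_mul]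
          calc _ ≤ |s1 x + l * s0 x| * (A * (b * x)) := by
                gcongr
                exacts [ha x hx, hw x hx]
            _ = A * b * (|s1 x + l * s0 x| * x) := by ring
            _ ≤ _ := by gcongr; exact hHr x hx
        have e2 : |3 * κ * (s1 x * w1 x)| ≤ 3 * κ * (H x * b) := by
          rw [abs_mul, abs_mul (s1 x), abs_of_pos (by positivity : 0 < 3 * κ)]
          have := hH0 x
          gcongr
          exacts [hH1 x hx, hw1 x hx]
        have e3 : |κ * (s3 x * w x)| ≤ κ * (b * H x) := by
          rw [abs_mul, abs_mul, abs_of_pos hκ]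
          calc _ ≤ κ * (|s3 x| * (b * x)) := by gcongr; exact hw x hx
            _ = κ * (b * (|s3 x| * x)) := by ring
            _ ≤ _ := by gcongr; exact hH3 x hx
        calc |k x| ≤ _ := abs_add_three _ _ _
          _ ≤ _ := add_le_add_three e1 e2 e3
          _ = _ := by ring
      · rw [expTail_const_mul]
        exact mul_le_mul_of_nonneg_left
          (expTail_le_of_antitone (Ioo_subset_Icc_self hy) hH (hH0 y) cH) (by positivity)
    have h2 : |3 * κ * (s1 y * w1 y)| ≤ 3 * κ * (H y * b) := by
      rw [abs_mul, abs_mul (s1 y), abs_of_pos (by positivity : 0 < 3 * κ)]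
      have := hH0 y
      gcongr
      exacts [hH1 y hy, hw1 y hy]
    calc _ ≤ _ := abs_sub _ _
      _ ≤ _ := add_le_add h1 h2
      _ = _ := by ring
  set C := (κ + A) + 2 * (κ + A) ^ 2 / κ + 7 * A + 1 with hC
  set Φ : ℝ → ℝ := fun y => κ * (-2 * ((1 - Real.exp (-y)) * (p y * p2 y))
      + (1 - Real.exp (-y)) * p1 y ^ 2 + 2 * (Real.exp (-y) * (p y * p1 y))
      + Real.exp (-y) * p y ^ 2) - (1 - Real.exp (-y)) * (a y * p y ^ 2)
      + (κ + A) * (y * (Real.exp (-y) * p y ^ 2))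
      + 2 * A * b * ((1 - Real.exp (-y)) * Z y ^ 2) with hΦ
  have key := intervalIntegral.integral_le_sub_of_hasDeriv_right_of_le (g := Φ)
    (g' := fun y => κ * (-2 * (1 - Real.exp (-y)) * p y * p3 y + 3 * Real.exp (-y) * p1 y ^ 2
        - Real.exp (-y) * p y ^ 2)
      - (Real.exp (-y) * a y * p y ^ 2 + (1 - Real.exp (-y)) * a1 y * p y ^ 2
        + 2 * (1 - Real.exp (-y)) * a y * p y * p1 y)
      + (κ + A) * (Real.exp (-y) * p y ^ 2 - y * Real.exp (-y) * p y ^ 2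
        + 2 * y * Real.exp (-y) * p y * p1 y)
      + 2 * A * b * (Real.exp (-y) * Z y ^ 2 + 2 * (1 - Real.exp (-y)) * Z y * (Z y - |p y|)))
    (φ := fun y => (1 - Real.exp (-y)) * (2 * p y * pt y)
      - C * (1 + b) * ((1 - Real.exp (-y)) * p y ^ 2) - b * (A + 7 * κ) ^ 2 * H y ^ 2)
    hM (Continuous.continuousOn (by fun_prop)) (fun y hy => by
      have de : HasDerivAt (fun y => Real.exp (-y)) (-Real.exp (-y)) y := by
        simpa using (hasDerivAt_neg y).exp
      have dψ : HasDerivAt (fun y => 1 - Real.exp (-y)) (Real.exp (-y)) y := by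
        simpa using de.const_sub 1
      have d := ((((((((dψ.mul ((dp y).mul (dp2 y hy))).const_mul (-2)).add
        (dψ.mul ((dp1 y hy).pow 2))).add
        ((de.mul ((dp y).mul (dp1 y hy))).const_mul 2)).add
        (de.mul ((dp y).pow 2))).const_mul κ).sub
        (dψ.mul ((da y hy).mul ((dp y).pow 2)))).add
        (((hasDerivAt_id y).mul (de.mul ((dp y).pow 2))).const_mul (κ + A))).add
        ((dψ.mul ((dZ y).pow 2)).const_mul (2 * A * b))
      refine (d.congr_deriv ?_).hasDerivWithinAt
      simp only [Pi.mul_apply, Pi.pow_apply, Nat.cast_ofNat, id]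
      ring)
    (Continuous.integrableOn_Icc (by fun_prop)) (fun y hy => by
      have hy' := Ioo_subset_Icc_self hy
      have hy0 : 0 < y := hy.1
      have e0 : 0 < Real.exp (-y) := Real.exp_pos _
      have hψ1 : 1 - Real.exp (-y) ≤ 1 := by linarith
      have hey : Real.exp (-y) * Real.exp y = 1 := by rw [← Real.exp_add]; simp
      have hyψ : y * Real.exp (-y) ≤ 1 - Real.exp (-y) := by
        nlinarith [Real.add_one_le_exp y]
      have hy2ψ : y ^ 2 * Real.exp (-y) ≤ 2 * (1 - Real.exp (-y)) := by
        nlinarith [Real.quadratic_le_exp_of_nonneg hy0.le]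
      have hψ0 : 0 ≤ 1 - Real.exp (-y) := by nlinarith
      have haA := abs_le.1 (ha y hy)
      have ha1A := abs_le.1 (ha1 y hy)
      have hZ0 : 0 ≤ Z y := by
        have := expTail_mono hy' (g := fun _ => 0 * 0) (h := fun x => |p x|) (by fun_prop)
          (by fun_prop) (fun x _ => by simp)
        rwa [expTail_const_mul, zero_mul] at this
      simp only [hev y hy']
      have hh := hk' y hy
      have hzy := hz' y hy'
      set h := expTail M k y - 3 * κ * (s1 y * w1 y)
      clear_value h
      have hψp : 0 ≤ (1 - Real.exp (-y)) * p y ^ 2 := by positivity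
      have hHy := hH0 y
      have hAb : 0 ≤ A * b := by positivity
      have f1 : 0 ≤ (A - a y) * (Real.exp (-y) * p y ^ 2) :=
        mul_nonneg (by linarith) (by positivity)
      have f2 : 0 ≤ κ * Real.exp (-y) * p1 y ^ 2 + 2 * (κ + A) * y * Real.exp (-y) * p y * p1 y
          + (κ + A) ^ 2 / κ * (y ^ 2 * Real.exp (-y)) * p y ^ 2 := by
        have : 0 ≤ Real.exp (-y) / κ * (κ * p1 y + (κ + A) * y * p y) ^ 2 := by positivity
        convert this using 1
        field_simp
        ring
      have f3 : (κ + A) * p y ^ 2 * (y * Real.exp (-y)) ≤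
          (κ + A) * p y ^ 2 * (1 - Real.exp (-y)) := by gcongr
      have f4 : (κ + A) ^ 2 / κ * p y ^ 2 * (y ^ 2 * Real.exp (-y)) ≤
          (κ + A) ^ 2 / κ * p y ^ 2 * (2 * (1 - Real.exp (-y))) := by gcongr
      have f5 : 0 ≤ (A * b - a1 y) * ((1 - Real.exp (-y)) * p y ^ 2) :=
        mul_nonneg (by linarith) hψp
      have f6 : 0 ≤ l * (A + a y) * ((1 - Real.exp (-y)) * p y ^ 2) :=
        mul_nonneg (mul_nonneg hl0 (by linarith)) hψp
      have f6' : 0 ≤ (1 - l) * A * ((1 - Real.exp (-y)) * p y ^ 2) :=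
        mul_nonneg (mul_nonneg (by linarith) hA) hψp
      have f7 : -(2 * (1 + l) * ((1 - Real.exp (-y)) * (p y * z y))) ≤
          4 * ((1 - Real.exp (-y)) * (|p y| * (A * b * Z y))) := by
        have h1 : -(p y * z y) ≤ |p y| * (A * b * Z y) := by
          refine (neg_le_abs _).trans ?_
          rw [abs_mul]
          gcongr
        have h2 : 0 ≤ |p y| * (A * b * Z y) := by positivity
        calc _ = 2 * (1 + l) * ((1 - Real.exp (-y)) * -(p y * z y)) := by ring
          _ ≤ 2 * (1 + l) * ((1 - Real.exp (-y)) * (|p y| * (A * b * Z y))) := by gcongr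
          _ ≤ 2 * (1 + 1) * ((1 - Real.exp (-y)) * (|p y| * (A * b * Z y))) := by gcongr
          _ = _ := by ring
      have f8 : 0 ≤ 4 * (A * b) * ((1 - Real.exp (-y)) * (|p y| - Z y) ^ 2) := by positivity
      have f9 : 2 * ((1 - Real.exp (-y)) * (p y * h)) ≤
          b * ((1 - Real.exp (-y)) * p y ^ 2) + b * (A + 7 * κ) ^ 2 * H y ^ 2 := by
        have h1 : p y * h ≤ |p y| * (b * ((A + 7 * κ) * H y)) := by
          refine (le_abs_self _).trans ?_
          rw [abs_mul]
          gcongr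
        calc _ ≤ 2 * ((1 - Real.exp (-y)) * (|p y| * (b * ((A + 7 * κ) * H y)))) := by gcongr
          _ = b * ((1 - Real.exp (-y)) * (2 * |p y| * ((A + 7 * κ) * H y))) := by ring
          _ ≤ b * ((1 - Real.exp (-y)) * (|p y| ^ 2 + ((A + 7 * κ) * H y) ^ 2)) := by
            gcongr
            exact two_mul_le_add_sq _ _
          _ = b * ((1 - Real.exp (-y)) * p y ^ 2)
              + (1 - Real.exp (-y)) * (b * (A + 7 * κ) ^ 2 * H y ^ 2) := by
            rw [sq_abs]
            ring
          _ ≤ _ := by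
            have : 0 ≤ b * (A + 7 * κ) ^ 2 * H y ^ 2 := by positivity
            linarith [mul_le_of_le_one_left this hψ1]
      have f10 : 0 ≤ (b * ((κ + A) + 2 * (κ + A) ^ 2 / κ) + 5 * A + 2 * A * b + 1) *
          ((1 - Real.exp (-y)) * p y ^ 2) := mul_nonneg (by positivity) hψp
      have f11 : 0 ≤ 2 * κ * Real.exp (-y) * p1 y ^ 2 := by positivity
      have f12 : 0 ≤ 2 * A * b * (Real.exp (-y) * Z y ^ 2) := by positivity
      have hab : |p y| ^ 2 = p y ^ 2 := sq_abs _
      have f8' : 4 * (A * b) * ((1 - Real.exp (-y)) * (|p y| - Z y) ^ 2) =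
          4 * (A * b) * ((1 - Real.exp (-y)) * (p y ^ 2 - 2 * |p y| * Z y + Z y ^ 2)) := by
        rw [← hab]
        ring
      rw [f8'] at f8
      rw [hC]
      have hK : 2 * (κ + A) ^ 2 / κ = 2 * ((κ + A) ^ 2 / κ) := by ring
      rw [hK] at f10 ⊢
      linarith)
  have hΦM : Φ M = 0 := by simp [hΦ, pM, p1M, ZM]
  have hΦ0 : 0 ≤ Φ 0 := by
    have : Φ 0 = κ * (3 * p 0 ^ 2) := by
      simp only [hΦ, hp1, hw0, neg_zero, Real.exp_zero, sub_self, mul_zero, zero_mul, sub_zero,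
        add_zero, zero_add, one_mul]
      ring
    rw [this]
    positivity
  rw [hΦM, intervalIntegral.integral_sub (Continuous.intervalIntegrable (by fun_prop) _ _)
    (Continuous.intervalIntegrable (by fun_prop) _ _),
    intervalIntegral.integral_sub (Continuous.intervalIntegrable (by fun_prop) _ _)
    (Continuous.intervalIntegrable (by fun_prop) _ _), intervalIntegral.integral_const_mul,
    intervalIntegral.integral_const_mul] at key
  linarith

theorem hasDerivAt_integral_of_continuous {G G' : ℝ → ℝ → ℝ}
    (hG : Continuous fun q : ℝ × ℝ => G q.1 q.2) (hG' : Continuous fun q : ℝ × ℝ => G' q.1 q.2)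
    {α β t : ℝ} {s : Set ℝ} (hs : s ∈ nhds t)
    (h : ∀ t ∈ s, ∀ x, HasDerivAt (fun r => G r x) (G' t x) t) :
    HasDerivAt (fun r => ∫ x in α..β, G r x) (∫ x in α..β, G' t x) t := by
  obtain ⟨B, hB⟩ := ((isCompact_closedBall t 1).prod (isCompact_uIcc (a := α) (b := β))
    ).exists_bound_of_continuousOn hG'.continuousOn
  have cG : ∀ r, Continuous (G r) := fun r => hG.comp (Continuous.prodMk_right r)
  have cG' : ∀ r, Continuous (G' r) := fun r => hG'.comp (Continuous.prodMk_right r)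
  refine (intervalIntegral.hasDerivAt_integral_of_dominated_loc_of_deriv_le
    (s := s ∩ Metric.closedBall t 1) (bound := fun _ => B)
    (Filter.inter_mem hs (Metric.closedBall_mem_nhds t one_pos))
    (.of_forall fun r => (cG r).aestronglyMeasurable) ((cG t).intervalIntegrable _ _)
    (cG' t).aestronglyMeasurable (.of_forall fun x hx r hr => ?_) (by simp)
    (.of_forall fun x _ r hr => h r hr.1 x)).2
  exact hB (r, x) ⟨hr.2, uIoc_subset_uIcc hx⟩

theorem continuous_expTail_param {g : ℝ → ℝ → ℝ} (hg : Continuous fun q : ℝ × ℝ => g q.1 q.2)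
    (M : ℝ) : Continuous fun q : ℝ × ℝ => expTail M (g q.1) q.2 := by
  have h := intervalIntegral.continuous_parametric_intervalIntegral_of_continuous (μ := volume)
    (a₀ := M) (f := fun (q : ℝ × ℝ) x => Real.exp (q.2 - x) * g q.1 x) (s := fun q => q.2)
    (by
      have : Continuous fun q : (ℝ × ℝ) × ℝ => g q.1.1 q.2 :=
        hg.comp (continuous_fst.fst.prodMk continuous_snd)
      simp only [Function.uncurry_def]
      fun_prop) continuous_snd
  refine h.neg.congr fun q => ?_
  rw [expTail, intervalIntegral.integral_symm]
  rfl

/-- The weighted negative-order energy of `w`. -/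
noncomputable def tailEnergy (M : ℝ) (w : ℝ → ℝ) : ℝ :=
  ∫ y in 0..M, (1 - Real.exp (-y)) * expTail M w y ^ 2

theorem continuous_tailEnergy {g : ℝ → ℝ → ℝ} (hg : Continuous fun q : ℝ × ℝ => g q.1 q.2)
    (M : ℝ) : Continuous fun t => tailEnergy M (g t) := by
  have := continuous_expTail_param hg M
  exact intervalIntegral.continuous_parametric_intervalIntegral_of_continuous'
    (f := fun t y => (1 - Real.exp (-y)) * expTail M (g t) y ^ 2)
    (by simp only [Function.uncurry_def]; fun_prop) 0 M

theorem hasDerivAt_tailEnergy {g g' : ℝ → ℝ → ℝ} (hg : Continuous fun q : ℝ × ℝ => g q.1 q.2)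
    (hg' : Continuous fun q : ℝ × ℝ => g' q.1 q.2) {t : ℝ} {s : Set ℝ} (hs : s ∈ nhds t)
    (h : ∀ t ∈ s, ∀ x, HasDerivAt (fun r => g r x) (g' t x) t) (M : ℝ) :
    HasDerivAt (fun r => tailEnergy M (g r))
      (∫ y in 0..M, (1 - Real.exp (-y)) * (2 * expTail M (g t) y * expTail M (g' t) y)) t := by
  have c := continuous_expTail_param hg M
  have c' := continuous_expTail_param hg' M
  have hs' : interior s ∈ nhds t := isOpen_interior.mem_nhds (mem_interior_iff_mem_nhds.2 hs)
  refine hasDerivAt_integral_of_continuous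
    (G' := fun t y => (1 - Real.exp (-y)) * (2 * expTail M (g t) y * expTail M (g' t) y))
    (by fun_prop) (by fun_prop) hs' fun r hr y => ?_
  have hd : HasDerivAt (fun r => expTail M (g r) y) (expTail M (g' r) y) r :=
    hasDerivAt_integral_of_continuous (G' := fun r x => Real.exp (y - x) * g' r x)
      (by fun_prop) (by fun_prop) (mem_interior_iff_mem_nhds.1 hr)
      fun r hr x => (h r hr x).const_mul _
  refine ((hd.pow 2).const_mul (1 - Real.exp (-y))).congr_deriv ?_
  simp

theorem gronwall_integrable {E E' k g : ℝ → ℝ} {a b : ℝ} (hE : ContinuousOn E (Icc a b))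
    (hE' : ∀ t ∈ Ioo a b, HasDerivAt E (E' t) t) (hk : IntegrableOn k (Icc a b))
    (hg : IntegrableOn g (Icc a b)) (hk0 : ∀ t ∈ Icc a b, 0 ≤ k t)
    (hg0 : ∀ t ∈ Icc a b, 0 ≤ g t) (hle : ∀ t ∈ Ioo a b, E' t ≤ k t * E t + g t)
    (ha : E a = 0) (hk2 : ∫ t in a..b, k t ≤ 1 / 2) :
    ∀ t ∈ Icc a b, E t ≤ 2 * ∫ t in a..b, g t := by
  intro t ht
  have hab : a ≤ b := ht.1.trans ht.2
  obtain ⟨m, hm, hmax⟩ := isCompact_Icc.exists_isMaxOn ⟨t, ht⟩ hE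
  have hS : 0 ≤ E m := ha ▸ hmax (left_mem_Icc.2 hab)
  have hsub : Icc a m ⊆ Icc a b := Icc_subset_Icc_right hm.2
  have hsub' : Ioo a m ⊆ Ioo a b := Ioo_subset_Ioo_right hm.2
  have h := intervalIntegral.sub_le_integral_of_hasDeriv_right_of_le
    (φ := fun t => k t * E m + g t) hm.1 (hE.mono hsub)
    (fun x hx => (hE' x (hsub' hx)).hasDerivWithinAt) (((hk.mono_set hsub).mul_const _).add
      (hg.mono_set hsub)) (fun x hx => (hle x (hsub' hx)).trans (by
        have := hmax (Ioo_subset_Icc_self (hsub' hx))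
        have := hk0 x (Ioo_subset_Icc_self (hsub' hx))
        gcongr
        assumption))
  have ik : ∀ c ∈ Icc a b, IntervalIntegrable k volume a c := fun c hc =>
    (intervalIntegrable_iff_integrableOn_Icc_of_le hc.1).2
      (hk.mono_set (Icc_subset_Icc_right hc.2))
  have ig : ∀ c ∈ Icc a b, IntervalIntegrable g volume a c := fun c hc =>
    (intervalIntegrable_iff_integrableOn_Icc_of_le hc.1).2
      (hg.mono_set (Icc_subset_Icc_right hc.2))
  rw [intervalIntegral.integral_add ((ik m hm).mul_const _) (ig m hm),
    intervalIntegral.integral_mul_const, ha] at h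
  have mono : ∀ {q : ℝ → ℝ}, (∀ c ∈ Icc a b, IntervalIntegrable q volume a c) →
      (∀ t ∈ Icc a b, 0 ≤ q t) → ∫ t in a..m, q t ≤ ∫ t in a..b, q t := by
    intro q hq hq0
    refine intervalIntegral.integral_mono_interval le_rfl hm.1 hm.2 ?_
      (hq b (right_mem_Icc.2 hab))
    exact (ae_restrict_mem measurableSet_Ioc).mono fun x hx => hq0 x (Ioc_subset_Icc_self hx)
  have hkm := mono ik hk0
  have hgm := mono ig hg0
  have := hmax ht
  have : E t ≤ E m := this
  nlinarith

/-- A spatial cutoff, vanishing at `1 / r ^ 2`, that is close to `exp (-r x)`. -/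
noncomputable def cutoff (r x : ℝ) : ℝ := Real.exp (-(r * x)) * (1 - r ^ 2 * x) ^ 4

noncomputable def cutoff₁ (r x : ℝ) : ℝ :=
  -(Real.exp (-(r * x)) * (r * (1 - r ^ 2 * x) ^ 4 + 4 * r ^ 2 * (1 - r ^ 2 * x) ^ 3))

noncomputable def cutoff₂ (r x : ℝ) : ℝ :=
  Real.exp (-(r * x)) * (r ^ 2 * (1 - r ^ 2 * x) ^ 4 + 8 * r ^ 3 * (1 - r ^ 2 * x) ^ 3
    + 12 * r ^ 4 * (1 - r ^ 2 * x) ^ 2)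

noncomputable def cutoff₃ (r x : ℝ) : ℝ :=
  -(Real.exp (-(r * x)) * (r ^ 3 * (1 - r ^ 2 * x) ^ 4 + 12 * r ^ 4 * (1 - r ^ 2 * x) ^ 3
    + 36 * r ^ 5 * (1 - r ^ 2 * x) ^ 2 + 24 * r ^ 6 * (1 - r ^ 2 * x)))

theorem hasDerivAt_exp_neg_mul (r x : ℝ) :
    HasDerivAt (fun x => Real.exp (-(r * x))) (-(r * Real.exp (-(r * x)))) x := by
  refine (((hasDerivAt_id x).const_mul r).neg.exp).congr_deriv ?_
  simp
  ring

theorem hasDerivAt_one_sub_sq_mul (r x : ℝ) :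
    HasDerivAt (fun x => 1 - r ^ 2 * x) (-r ^ 2) x := by
  simpa using ((hasDerivAt_id x).const_mul (r ^ 2)).const_sub 1

theorem hasDerivAt_cutoff (r x : ℝ) : HasDerivAt (cutoff r) (cutoff₁ r x) x := by
  have e := hasDerivAt_exp_neg_mul r x
  have s := hasDerivAt_one_sub_sq_mul r x
  refine (e.mul (s.pow 4)).congr_deriv ?_
  simp only [cutoff₁, Pi.pow_apply, Nat.cast_ofNat]
  ring

theorem hasDerivAt_cutoff₁ (r x : ℝ) : HasDerivAt (cutoff₁ r) (cutoff₂ r x) x := by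
  have e := hasDerivAt_exp_neg_mul r x
  have s := hasDerivAt_one_sub_sq_mul r x
  refine (e.mul (((s.pow 4).const_mul r).add ((s.pow 3).const_mul (4 * r ^ 2)))).neg.congr_deriv ?_
  simp only [cutoff₂, Pi.pow_apply, Pi.add_apply, Nat.cast_ofNat]
  ring

theorem hasDerivAt_cutoff₂ (r x : ℝ) : HasDerivAt (cutoff₂ r) (cutoff₃ r x) x := by
  have e := hasDerivAt_exp_neg_mul r x
  have s := hasDerivAt_one_sub_sq_mul r x
  refine (e.mul ((((s.pow 4).const_mul (r ^ 2)).add ((s.pow 3).const_mul (8 * r ^ 3))).add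
    ((s.pow 2).const_mul (12 * r ^ 4)))).congr_deriv ?_
  simp only [cutoff₃, Pi.pow_apply, Pi.add_apply, Nat.cast_ofNat]
  ring

theorem continuous_cutoff (r : ℝ) : Continuous (cutoff r) := by unfold cutoff; fun_prop

theorem cutoff_bounds {r x : ℝ} (hr : 0 < r) (hr1 : r ≤ 1) (hx0 : 0 < x) (hx : r ^ 2 * x < 1) :
    |cutoff₁ r x| ≤ 146 * r * Real.exp (-(r / 2 * x)) ∧
    |cutoff₁ r x + r * cutoff r x| * x ≤ 146 * r * Real.exp (-(r / 2 * x)) ∧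
    |cutoff₃ r x| * x ≤ 146 * r * Real.exp (-(r / 2 * x)) := by
  unfold cutoff cutoff₁ cutoff₃
  have hE : Real.exp (-(r * x)) = Real.exp (-(r / 2 * x)) * Real.exp (-(r / 2 * x)) := by
    rw [← Real.exp_add]
    ring_nf
  rw [hE]
  have hxE : r * x * Real.exp (-(r / 2 * x)) ≤ 2 := by
    have h1 := Real.add_one_le_exp (r / 2 * x)
    have h2 : Real.exp (-(r / 2 * x)) * Real.exp (r / 2 * x) = 1 := by rw [← Real.exp_add]; simp
    nlinarith [Real.exp_pos (-(r / 2 * x))]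
  have hE0 : 0 < Real.exp (-(r / 2 * x)) := Real.exp_pos _
  have hE1 : Real.exp (-(r / 2 * x)) ≤ 1 := Real.exp_le_one_iff.2 (by
    have : 0 < r / 2 * x := by positivity
    linarith)
  generalize Real.exp (-(r / 2 * x)) = E at *
  have hs0 : 0 ≤ 1 - r ^ 2 * x := by linarith
  have hs1 : 1 - r ^ 2 * x ≤ 1 := by nlinarith [sq_nonneg r]
  generalize 1 - r ^ 2 * x = s at *
  have hs2 : s ^ 2 ≤ 1 := pow_le_one₀ hs0 hs1
  have hs3 : s ^ 3 ≤ 1 := pow_le_one₀ hs0 hs1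
  have hs4 : s ^ 4 ≤ 1 := pow_le_one₀ hs0 hs1
  have hrp : ∀ n, r ^ (n + 1) ≤ r := fun n => by
    rw [pow_succ]
    exact mul_le_of_le_one_left hr.le (pow_le_one₀ hr.le hr1)
  have hrp2 : ∀ n, r ^ (n + 2) ≤ r ^ 2 := fun n => by
    rw [pow_add]
    exact mul_le_of_le_one_left (by positivity) (pow_le_one₀ hr.le hr1)
  refine ⟨?_, ?_, ?_⟩
  · rw [abs_neg, abs_of_nonneg (by positivity)]
    calc E * E * (r * s ^ 4 + 4 * r ^ 2 * s ^ 3) ≤ E * 1 * (r * 1 + 4 * r * 1) := by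
          gcongr
          exact hrp 1
      _ ≤ _ := by nlinarith [mul_pos hr hE0]
  · have e : -(E * E * (r * s ^ 4 + 4 * r ^ 2 * s ^ 3)) + r * (E * E * s ^ 4)
        = -(4 * r ^ 2 * s ^ 3 * (E * E)) := by ring
    rw [e, abs_neg, abs_of_nonneg (by positivity)]
    calc 4 * r ^ 2 * s ^ 3 * (E * E) * x = 4 * r * s ^ 3 * E * (r * x * E) := by ring
      _ ≤ 4 * r * 1 * E * 2 := by gcongr
      _ ≤ _ := by nlinarith [mul_pos hr hE0]
  · rw [abs_neg, abs_of_nonneg (by positivity)]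
    calc E * E * (r ^ 3 * s ^ 4 + 12 * r ^ 4 * s ^ 3 + 36 * r ^ 5 * s ^ 2 + 24 * r ^ 6 * s) * x
        ≤ E * E * (r ^ 2 * 1 + 12 * r ^ 2 * 1 + 36 * r ^ 2 * 1 + 24 * r ^ 2 * 1) * x := by
          have h1 := mul_le_mul (hrp2 1) hs4 (by positivity) (by positivity)
          have h2 := mul_le_mul (hrp2 2) hs3 (by positivity) (by positivity)
          have h3 := mul_le_mul (hrp2 3) hs2 (by positivity) (by positivity)
          have h4 := mul_le_mul (hrp2 4) hs1 (by positivity) (by positivity)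
          norm_num at h1 h2 h3 h4
          refine mul_le_mul_of_nonneg_right (mul_le_mul_of_nonneg_left ?_ (by positivity)) hx0.le
          linarith
      _ = 73 * r * E * (r * x * E) := by ring
      _ ≤ 73 * r * E * 2 := by gcongr
      _ = _ := by ring

theorem integral_sq_exp_le {r M : ℝ} (hr : 0 < r) (c : ℝ) :
    ∫ y in 0..M, (c * r * Real.exp (-(r / 2 * y))) ^ 2 ≤ c ^ 2 * r := by
  have h := intervalIntegral.integral_eq_sub_of_hasDerivAt (a := 0) (b := M)
    (f := fun y => -(c ^ 2 * r * Real.exp (-(r * y))))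
    (f' := fun y => (c * r * Real.exp (-(r / 2 * y))) ^ 2) (fun y _ => by
      refine ((hasDerivAt_exp_neg_mul r y).const_mul (c ^ 2 * r)).neg.congr_deriv ?_
      have : Real.exp (-(r * y)) = Real.exp (-(r / 2 * y)) * Real.exp (-(r / 2 * y)) := by
        rw [← Real.exp_add]
        ring_nf
      rw [this]
      ring) (Continuous.intervalIntegrable (by fun_prop) _ _)
  rw [h]
  have : 0 ≤ c ^ 2 * r * Real.exp (-(r * M)) := by positivity
  simp
  linarith

theorem mul_le_young {A ψ ρ p η : ℝ} (hψ : 0 < ψ) (hρ : 0 < ρ) (hA : η ^ 2 ≤ A) :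
    p * η ≤ ρ⁻¹ * (ψ * p ^ 2) + ρ * (A / ψ) := by
  have e : ρ⁻¹ * (ψ * p ^ 2) + ρ * (η ^ 2 / ψ) - p * η =
      (ψ * p - ρ * η / 2) ^ 2 / (ρ * ψ) + 3 / 4 * (ρ * (η ^ 2 / ψ)) := by
    field_simp
    ring
  have h : 0 ≤ (ψ * p - ρ * η / 2) ^ 2 / (ρ * ψ) + 3 / 4 * (ρ * (η ^ 2 / ψ)) := by positivity
  have h2 : ρ * (η ^ 2 / ψ) ≤ ρ * (A / ψ) := by gcongr
  linarith

/-- The pairing of a function with a bump is controlled by its negative-order energy. -/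
theorem integral_mul_bump_le {g : ℝ → ℝ} (hg : Continuous g) {M α β ρ K : ℝ} (hα : 0 < α)
    (hαβ : α < β) (hβM : β ≤ M) (hρ : 0 < ρ) (hE : tailEnergy M g ≤ K * ρ ^ 2) :
    ∫ x in α..β, g x * ((x - α) * (β - x)) ≤
      (K + (β - α) * (((β - α) ^ 2 + (β - α)) ^ 2 / (1 - Real.exp (-α)))) * ρ := by
  have hψ : 0 < 1 - Real.exp (-α) := by
    have : Real.exp (-α) < 1 := Real.exp_lt_one_iff.2 (by linarith)
    linarith
  have cp : Continuous (expTail M g) := continuous_expTail hg M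
  have hd : ∀ x, HasDerivAt (expTail M g) (expTail M g x - g x) x := hasDerivAt_expTail hg M
  unfold tailEnergy at hE
  generalize expTail M g = p at *
  have key := intervalIntegral.integral_eq_sub_of_hasDerivAt (a := α) (b := β)
    (f := fun x => p x * ((x - α) * (β - x)))
    (f' := fun x => p x * ((x - α) * (β - x) + (α + β - 2 * x)) - g x * ((x - α) * (β - x)))
    (fun x _ => by
      refine ((hd x).mul (((hasDerivAt_id x).sub_const α).mul
        ((hasDerivAt_id x).const_sub β))).congr_deriv ?_
      simp
      ring) (Continuous.intervalIntegrable (by fun_prop) _ _)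
  rw [intervalIntegral.integral_sub (Continuous.intervalIntegrable (by fun_prop) _ _)
    (Continuous.intervalIntegrable (by fun_prop) _ _)] at key
  have h1 : ∫ x in α..β, p x * ((x - α) * (β - x) + (α + β - 2 * x)) ≤
      ∫ x in α..β, (ρ⁻¹ * ((1 - Real.exp (-x)) * p x ^ 2) +
        ρ * (((β - α) ^ 2 + (β - α)) ^ 2 / (1 - Real.exp (-α)))) := by
    refine intervalIntegral.integral_mono_on hαβ.le
      (Continuous.intervalIntegrable (by fun_prop) _ _)
      (Continuous.intervalIntegrable (by fun_prop) _ _) fun x hx => ?_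
    have hη : ((x - α) * (β - x) + (α + β - 2 * x)) ^ 2 ≤ ((β - α) ^ 2 + (β - α)) ^ 2 := by
      have h1 := sub_nonneg.2 hx.1
      have h2 := sub_nonneg.2 hx.2
      refine sq_le_sq' ?_ ?_ <;> nlinarith [mul_nonneg h1 h2]
    refine (mul_le_young hψ hρ hη).trans ?_
    have : Real.exp (-x) ≤ Real.exp (-α) := Real.exp_le_exp.2 (by linarith [hx.1])
    gcongr
  have h2 : ∫ x in α..β, (1 - Real.exp (-x)) * p x ^ 2 ≤ K * ρ ^ 2 := by
    refine le_trans (intervalIntegral.integral_mono_interval hα.le hαβ.le hβM ?_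
      (Continuous.intervalIntegrable (by fun_prop) _ _)) hE
    refine (ae_restrict_mem measurableSet_Ioc).mono fun x hx => ?_
    have : Real.exp (-x) ≤ 1 := Real.exp_le_one_iff.2 (by linarith [hx.1])
    exact mul_nonneg (by linarith) (sq_nonneg _)
  rw [intervalIntegral.integral_add (Continuous.intervalIntegrable (by fun_prop) _ _)
    (Continuous.intervalIntegrable (by fun_prop) _ _),
    intervalIntegral.integral_const_mul, intervalIntegral.integral_const, smul_eq_mul] at h1
  have h3 : ρ⁻¹ * ∫ x in α..β, (1 - Real.exp (-x)) * p x ^ 2 ≤ ρ⁻¹ * (K * ρ ^ 2) := by gcongr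
  have h4 : ρ⁻¹ * (K * ρ ^ 2) = K * ρ := by field_simp
  simp only [sub_self, zero_mul, mul_zero] at key
  linarith

theorem le_integral_mul_bump {w : ℝ → ℝ} {r α β m : ℝ} (hw : Continuous w) (hα : 0 < α)
    (hαβ : α < β) (hr0 : 0 < r) (hr1 : r ≤ 1) (hr : r * (2 * β) ≤ 1) (hm : 0 ≤ m)
    (hwu : ∀ x ∈ Icc α β, m ≤ w x) :
    Real.exp (-1) * (1 / 2) ^ 4 * m * ∫ x in α..β, (x - α) * (β - x) ≤
      ∫ x in α..β, cutoff r x * w x * ((x - α) * (β - x)) := by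
  have hσc := continuous_cutoff r
  rw [← intervalIntegral.integral_const_mul]
  refine intervalIntegral.integral_mono_on hαβ.le
    (Continuous.intervalIntegrable (by fun_prop) _ _)
    (Continuous.intervalIntegrable (by fun_prop) _ _) fun x hx => ?_
  have h1 : 0 ≤ x - α := sub_nonneg.2 hx.1
  have h2 : 0 ≤ β - x := sub_nonneg.2 hx.2
  have h3 : r * x ≤ r * β := by gcongr; exact hx.2
  have h4 : r ^ 2 * x ≤ r * x := by
    have : 0 < x := hα.trans_le hx.1
    rw [sq]
    gcongr
    exact mul_le_of_le_one_left hr0.le hr1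
  have h5 : Real.exp (-1) ≤ Real.exp (-(r * x)) := Real.exp_le_exp.2 (by linarith)
  have h6 : (1 / 2 : ℝ) ^ 4 ≤ (1 - r ^ 2 * x) ^ 4 := by
    refine pow_le_pow_left₀ (by norm_num) ?_ 4
    linarith
  refine mul_le_mul_of_nonneg_right ?_ (mul_nonneg h1 h2)
  have := hwu x hx
  unfold cutoff
  exact mul_le_mul (mul_le_mul h5 h6 (by positivity) (by positivity)) this hm (by positivity)

theorem nonpos_of_tailEnergy_le {u : ℝ → ℝ} {w : ℝ → ℝ → ℝ} (hu : ContinuousOn u (Ici 0))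
    (hw : ∀ r ∈ Ioc (0 : ℝ) 1, Continuous (w r))
    (hwu : ∀ r ∈ Ioc (0 : ℝ) 1, ∀ x ∈ Icc 0 (r ^ 2)⁻¹, w r x = u x) {K : ℝ} (hK : 0 ≤ K)
    (hE : ∀ r ∈ Ioc (0 : ℝ) 1, tailEnergy (r ^ 2)⁻¹ (fun x => cutoff r x * w r x) ≤ K * r) :
    ∀ x > 0, u x ≤ 0 := by
  intro x₀ hx₀
  by_contra! hpos
  have hc : ContinuousAt u x₀ := hu.continuousAt (Ici_mem_nhds hx₀)
  obtain ⟨d, hd, hd'⟩ := Metric.eventually_nhds_iff.1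
    ((hc.eventually (lt_mem_nhds (half_lt_self hpos))).and (lt_mem_nhds hx₀))
  have hαβ : x₀ - d / 2 < x₀ + d / 2 := by linarith
  have hum : ∀ x ∈ Icc (x₀ - d / 2) (x₀ + d / 2), u x₀ / 2 < u x ∧ 0 < x := fun x hx => hd' (by
    rw [Real.dist_eq, abs_lt]
    constructor <;> linarith [hx.1, hx.2])
  have hm : 0 < u x₀ / 2 := half_pos hpos
  generalize u x₀ / 2 = m at *
  generalize x₀ - d / 2 = α at *
  generalize x₀ + d / 2 = β at *
  have hα0 : 0 < α := (hum α (left_mem_Icc.2 hαβ.le)).2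
  have hβ0 : 0 < β := hα0.trans hαβ
  have hI0 : 0 < ∫ x in α..β, (x - α) * (β - x) := intervalIntegral.intervalIntegral_pos_of_pos_on
    (Continuous.intervalIntegrable (by fun_prop) _ _)
    (fun x hx => mul_pos (sub_pos.2 hx.1) (sub_pos.2 hx.2)) hαβ
  have hψ : 0 ≤ 1 - Real.exp (-α) := by
    have : Real.exp (-α) ≤ 1 := Real.exp_le_one_iff.2 (by linarith)
    linarith
  have hβα : 0 < β - α := sub_pos.2 hαβ
  have main : ∀ ρ : ℝ, 0 < ρ → ρ ≤ 1 → ρ * (2 * β) ≤ 1 → Real.exp (-1) * (1 / 2) ^ 4 * m *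
      ∫ x in α..β, (x - α) * (β - x) ≤
      (K + (β - α) * (((β - α) ^ 2 + (β - α)) ^ 2 / (1 - Real.exp (-α)))) * ρ := by
    intro ρ hρ hρ1 hρβ
    have hrρ : ρ ^ 2 ≤ ρ := by nlinarith
    have hr0 : 0 < ρ ^ 2 := by positivity
    have hr1 : ρ ^ 2 ≤ 1 := hrρ.trans hρ1
    have hrr : (ρ ^ 2) ^ 2 ≤ ρ := by nlinarith
    have hβM : β ≤ ((ρ ^ 2) ^ 2)⁻¹ := by
      rw [le_inv_comm₀ hβ0 (by positivity), ← one_div, le_div_iff₀ hβ0]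
      nlinarith
    have hwc := hw _ ⟨hr0, hr1⟩
    have hσc := continuous_cutoff (ρ ^ 2)
    refine (le_integral_mul_bump hwc hα0 hαβ hr0 hr1 ?_ hm.le fun x hx => ?_).trans
      (integral_mul_bump_le (by fun_prop) hα0 hαβ hβM hρ (hE _ ⟨hr0, hr1⟩))
    · exact (mul_le_mul_of_nonneg_right hrρ (by positivity)).trans hρβ
    · rw [hwu _ ⟨hr0, hr1⟩ x ⟨(hum x hx).2.le, hx.2.trans hβM⟩]
      exact (hum x hx).1.le
  have hc0 : 0 < Real.exp (-1) * (1 / 2) ^ 4 * m * ∫ x in α..β, (x - α) * (β - x) := by positivity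
  have hK₂ : 0 ≤ K + (β - α) * (((β - α) ^ 2 + (β - α)) ^ 2 / (1 - Real.exp (-α))) := by
    positivity
  generalize Real.exp (-1) * (1 / 2) ^ 4 * m * ∫ x in α..β, (x - α) * (β - x) = c at *
  generalize K + (β - α) * (((β - α) ^ 2 + (β - α)) ^ 2 / (1 - Real.exp (-α))) = K₂ at *
  have hρ0 : 0 < min 1 (min (2 * β)⁻¹ (c / (2 * (K₂ + 1)))) := by
    simp only [lt_min_iff]
    exact ⟨one_pos, by positivity, by positivity⟩
  have h0 : min 1 (min (2 * β)⁻¹ (c / (2 * (K₂ + 1)))) ≤ 1 := min_le_left _ _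
  have h1 : min 1 (min (2 * β)⁻¹ (c / (2 * (K₂ + 1)))) ≤ (2 * β)⁻¹ :=
    (min_le_right _ _).trans (min_le_left _ _)
  have h2 : min 1 (min (2 * β)⁻¹ (c / (2 * (K₂ + 1)))) ≤ c / (2 * (K₂ + 1)) :=
    (min_le_right _ _).trans (min_le_right _ _)
  generalize min 1 (min (2 * β)⁻¹ (c / (2 * (K₂ + 1)))) = ρ at *
  rw [le_div_iff₀ (by positivity)] at h2
  have h3 : ρ * (2 * β) ≤ 1 := by
    rwa [← one_div, le_div_iff₀ (by positivity)] at h1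
  nlinarith [main ρ hρ0 h0 h3]

theorem exists_continuous_extension_time {T : ℝ} (hT : 0 < T) {v : ℝ → ℝ → ℝ}
    (hv : ContDiffOn ℝ 1 (fun p : ℝ × ℝ => v p.1 p.2) (Icc 0 T ×ˢ Ici 0)) :
    ∃ V V' : ℝ → ℝ → ℝ, (Continuous fun q : ℝ × ℝ => V q.1 q.2) ∧
      (Continuous fun q : ℝ × ℝ => V' q.1 q.2) ∧
      (∀ t ∈ Ioo 0 T, ∀ x, HasDerivAt (fun s => V s x) (V' t x) t) ∧
      (∀ t ∈ Icc 0 T, ∀ x, V t x = v t (max 0 x)) ∧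
      (∀ t ∈ Ioo 0 T, ∀ x ≥ 0, V' t x = deriv (fun s => v s x) t) := by
  set S : Set (ℝ × ℝ) := Icc 0 T ×ˢ Ici 0 with hS
  have hU : UniqueDiffOn ℝ S := (uniqueDiffOn_Icc hT).prod (uniqueDiffOn_Ici 0)
  have hproj : ∀ t x : ℝ, (max 0 (min t T), max 0 x) ∈ S := fun t x =>
    ⟨⟨le_max_left _ _, max_le hT.le (min_le_right _ _)⟩, mem_Ici.2 (le_max_left 0 x)⟩
  have hcl : ∀ t ∈ Icc 0 T, max 0 (min t T) = t := fun t ht => by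
    rw [min_eq_left ht.2, max_eq_right ht.1]
  have hd : ∀ t ∈ Ioo 0 T, ∀ x ≥ 0, HasDerivAt (fun s => v s x)
      (fderivWithin ℝ (fun p : ℝ × ℝ => v p.1 p.2) S (t, x) (1, 0)) t := by
    intro t ht x hx
    have h1 := ((hv.differentiableOn (by norm_num)) (t, x)
      ⟨Ioo_subset_Icc_self ht, hx⟩).hasFDerivWithinAt
    have h2 : HasDerivWithinAt (fun s : ℝ => (s, x)) (1, 0) (Icc 0 T) t :=
      ((hasDerivAt_id t).prodMk (hasDerivAt_const t x)).hasDerivWithinAt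
    exact (h1.comp_hasDerivWithinAt t h2 fun s hs => show (s, x) ∈ S from ⟨hs, hx⟩).hasDerivAt
      (Icc_mem_nhds ht.1 ht.2)
  refine ⟨fun t x => v (max 0 (min t T)) (max 0 x),
    fun t x => fderivWithin ℝ (fun p : ℝ × ℝ => v p.1 p.2) S
      (max 0 (min t T), max 0 x) (1, 0), ?_, ?_, ?_, ?_, ?_⟩
  · exact hv.continuousOn.comp_continuous
      (f := fun q : ℝ × ℝ => (max 0 (min q.1 T), max 0 q.2)) (by fun_prop) fun q => hproj _ _
  · exact ((hv.continuousOn_fderivWithin hU le_rfl).comp_continuous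
      (f := fun q : ℝ × ℝ => (max 0 (min q.1 T), max 0 q.2)) (by fun_prop)
      fun q => hproj _ _).clm_apply continuous_const
  · intro t ht x
    have h := hd t ht (max 0 x) (le_max_left _ _)
    simp only [hcl t (Ioo_subset_Icc_self ht)]
    refine h.congr_of_eventuallyEq ?_
    filter_upwards [Icc_mem_nhds ht.1 ht.2] with s hs
    rw [hcl s hs]
  · intro t ht x
    simp only [hcl t ht]
  · intro t ht x hx
    rw [(hd t ht x hx).deriv]
    simp only [hcl t (Ioo_subset_Icc_self ht), max_eq_right hx]

theorem ContDiffOn.exists_derivWithin_Ici {n : ℕ} {v : ℝ → ℝ}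
    (hv : ContDiffOn ℝ (n + 1) v (Ici 0)) :
    ∃ v' : ℝ → ℝ, ContDiffOn ℝ n v' (Ici 0) ∧ ∀ x > 0, HasDerivAt v (v' x) x := by
  obtain ⟨h1, -, h2⟩ := (contDiffOn_succ_iff_derivWithin (uniqueDiffOn_Ici 0)).1 hv
  exact ⟨_, h2, fun x hx => (h1 x hx.le).hasDerivWithinAt.hasDerivAt (Ici_mem_nhds hx)⟩

theorem HasDerivAt.comp_max_zero {v v' : ℝ → ℝ} (h : ∀ x > 0, HasDerivAt v (v' x) x) :
    ∀ x > 0, HasDerivAt (fun x => v (max 0 x)) (v' (max 0 x)) x := by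
  intro x hx
  rw [max_eq_right hx.le]
  refine (h x hx).congr_of_eventuallyEq ?_
  filter_upwards [Ioi_mem_nhds hx] with y hy
  rw [max_eq_right (le_of_lt hy)]

theorem exists_continuous_derivs {v : ℝ → ℝ} (hv : ContDiffOn ℝ 3 v (Ici 0)) :
    ∃ v1 v2 v3 : ℝ → ℝ, Continuous v1 ∧ Continuous v2 ∧
      (∀ x > 0, HasDerivAt (fun x => v (max 0 x)) (v1 x) x) ∧
      (∀ x > 0, HasDerivAt v1 (v2 x) x) ∧ (∀ x > 0, HasDerivAt v2 (v3 x) x) ∧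
      (∀ x > 0, v1 x = deriv v x) ∧ (∀ x > 0, v3 x = deriv (deriv (deriv v)) x) := by
  obtain ⟨w1, c1, d1⟩ := ContDiffOn.exists_derivWithin_Ici (n := 2) (by norm_num; exact hv)
  obtain ⟨w2, c2, d2⟩ := ContDiffOn.exists_derivWithin_Ici (n := 1) (by norm_num; exact c1)
  obtain ⟨w3, c3, d3⟩ := ContDiffOn.exists_derivWithin_Ici (n := 0) (by norm_num; exact c2)
  have hmax : ∀ {g : ℝ → ℝ} {n : ℕ}, ContDiffOn ℝ n g (Ici 0) →
      Continuous fun x => g (max 0 x) := fun h =>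
    h.continuousOn.comp_continuous (by fun_prop) fun x => le_max_left 0 x
  have e1 : ∀ x > 0, deriv v x = w1 x := fun x hx => (d1 x hx).deriv
  have ev : ∀ {g h : ℝ → ℝ}, (∀ x > 0, g x = h x) → ∀ x > 0, g =ᶠ[nhds x] h :=
    fun hgh x hx => Filter.mem_of_superset (Ioi_mem_nhds hx) hgh
  have e2 : ∀ x > 0, deriv (deriv v) x = w2 x := fun x hx =>
    (ev e1 x hx).deriv_eq.trans (d2 x hx).deriv
  have e3 : ∀ x > 0, deriv (deriv (deriv v)) x = w3 x := fun x hx =>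
    (ev e2 x hx).deriv_eq.trans (d3 x hx).deriv
  refine ⟨fun x => w1 (max 0 x), fun x => w2 (max 0 x), fun x => w3 (max 0 x), hmax c1, hmax c2,
    HasDerivAt.comp_max_zero d1, HasDerivAt.comp_max_zero d2, HasDerivAt.comp_max_zero d3,
    fun x hx => ?_, fun x hx => ?_⟩
  · simp only [max_eq_right hx.le, e1 x hx]
  · simp only [max_eq_right hx.le, e3 x hx]

/-- The averaged coefficient in `f (p x) - f (q x) = a x * (p x - q x)`. -/
theorem exists_averaged_deriv {f : ℝ → ℝ} (hf : ContDiff ℝ 2 f) {A : ℝ}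
    (hf1 : ∀ x, |deriv f x| ≤ A) (hf2 : ∀ x, |deriv (deriv f) x| ≤ A)
    {p q p' q' : ℝ → ℝ} (cp : Continuous p) (cq : Continuous q) (cp' : Continuous p')
    (cq' : Continuous q') (dp : ∀ x > 0, HasDerivAt p (p' x) x)
    (dq : ∀ x > 0, HasDerivAt q (q' x) x) :
    ∃ a a' : ℝ → ℝ, Continuous a ∧ Continuous a' ∧ (∀ x > 0, HasDerivAt a (a' x) x) ∧
      (∀ x, f (p x) - f (q x) = a x * (p x - q x)) ∧ (∀ x, |a x| ≤ A) ∧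
      ∀ x, |a' x| ≤ A * (|p' x| + |q' x|) := by
  have hfd : ∀ y, HasDerivAt f (deriv f y) y := fun y =>
    (hf.differentiable (by norm_num) y).hasDerivAt
  have hf' : ContDiff ℝ 1 (deriv f) := by
    have : ContDiff ℝ (1 + 1) f := by norm_num; exact hf
    exact (contDiff_succ_iff_deriv.1 this).2.2
  have hfd' : ∀ y, HasDerivAt (deriv f) (deriv (deriv f) y) y := fun y =>
    (hf'.differentiable (by norm_num) y).hasDerivAt
  have cf' : Continuous (deriv f) := hf'.continuous
  have cf'' : Continuous (deriv (deriv f)) := hf'.continuous_deriv le_rfl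
  have c1 : Continuous fun z : ℝ × ℝ => deriv f (q z.1 + z.2 * (p z.1 - q z.1)) := by fun_prop
  have c2 : Continuous fun z : ℝ × ℝ => deriv (deriv f) (q z.1 + z.2 * (p z.1 - q z.1)) *
    (q' z.1 + z.2 * (p' z.1 - q' z.1)) := by fun_prop
  refine ⟨fun x => ∫ θ in 0..1, deriv f (q x + θ * (p x - q x)),
    fun x => ∫ θ in 0..1, deriv (deriv f) (q x + θ * (p x - q x)) *
      (q' x + θ * (p' x - q' x)), ?_, ?_, fun x hx => ?_, fun x => ?_, fun x => ?_, fun x => ?_⟩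
  · exact intervalIntegral.continuous_parametric_intervalIntegral_of_continuous'
      (f := fun x θ => deriv f (q x + θ * (p x - q x))) c1 0 1
  · exact intervalIntegral.continuous_parametric_intervalIntegral_of_continuous'
      (f := fun x θ => deriv (deriv f) (q x + θ * (p x - q x)) *
        (q' x + θ * (p' x - q' x))) c2 0 1
  · refine hasDerivAt_integral_of_continuous
      (G := fun x θ => deriv f (q x + θ * (p x - q x)))
      (G' := fun x θ => deriv (deriv f) (q x + θ * (p x - q x)) * (q' x + θ * (p' x - q' x)))
      c1 c2 (Ioi_mem_nhds hx) fun y hy θ => ?_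
    exact (hfd' _).comp y ((dq y hy).add (((dp y hy).sub (dq y hy)).const_mul θ))
  · have h := intervalIntegral.integral_eq_sub_of_hasDerivAt (a := 0) (b := 1)
      (f := fun θ => f (q x + θ * (p x - q x)))
      (f' := fun θ => deriv f (q x + θ * (p x - q x)) * (p x - q x)) (fun θ _ => by
        have : HasDerivAt (fun θ => q x + θ * (p x - q x)) (p x - q x) θ := by
          simpa using ((hasDerivAt_id θ).mul_const (p x - q x)).const_add (q x)
        exact (hfd _).comp θ this) (Continuous.intervalIntegrable (by fun_prop) _ _)
    rw [intervalIntegral.integral_mul_const] at h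
    simp only [zero_mul, add_zero, one_mul, add_sub_cancel] at h
    exact h.symm
  · simpa using intervalIntegral.norm_integral_le_of_norm_le_const (a := (0 : ℝ)) (b := 1)
      (f := fun θ => deriv f (q x + θ * (p x - q x))) fun θ _ => hf1 _
  · have hA : 0 ≤ A := (abs_nonneg _).trans (hf1 0)
    simpa using intervalIntegral.norm_integral_le_of_norm_le_const (a := (0 : ℝ)) (b := 1)
      (C := A * (|p' x| + |q' x|))
      (f := fun θ => deriv (deriv f) (q x + θ * (p x - q x)) * (q' x + θ * (p' x - q' x)))
      fun θ hθ => by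
        rw [uIoc_of_le zero_le_one] at hθ
        rw [Real.norm_eq_abs, abs_mul]
        refine mul_le_mul (hf2 _) ?_ (abs_nonneg _) hA
        have e : q' x + θ * (p' x - q' x) = θ * p' x + (1 - θ) * q' x := by ring
        rw [e]
        refine (abs_add_le _ _).trans ?_
        rw [abs_mul, abs_mul, abs_of_pos hθ.1, abs_of_nonneg (sub_nonneg.2 hθ.2)]
        gcongr
        · exact mul_le_of_le_one_left (abs_nonneg _) hθ.2
        · exact mul_le_of_le_one_left (abs_nonneg _) (by linarith [hθ.1])

theorem abs_le_mul_of_hasDerivAt {w w' : ℝ → ℝ} {b : ℝ} (cw : Continuous w)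
    (dw : ∀ x > 0, HasDerivAt w (w' x) x) (hw' : ∀ x > 0, |w' x| ≤ b) (h0 : w 0 = 0) :
    ∀ x > 0, |w x| ≤ b * x := by
  intro x hx
  obtain ⟨c, hc, h⟩ := exists_hasDerivAt_eq_slope w w' hx cw.continuousOn fun y hy => dw y hy.1
  have h1 := hw' c hc.1
  rwa [h, h0, sub_zero, sub_zero, abs_div, abs_of_pos hx, div_le_iff₀ hx] at h1

theorem deriv_tailEnergy_le {f : ℝ → ℝ} (hf : ContDiff ℝ 2 f) {κ A b r : ℝ} (hκ : 0 < κ)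
    (hf1 : ∀ x, |deriv f x| ≤ A) (hf2 : ∀ x, |deriv (deriv f) x| ≤ A) {v₁ v₂ v' : ℝ → ℝ}
    (h₁ : ContDiffOn ℝ 3 v₁ (Ici 0)) (h₂ : ContDiffOn ℝ 3 v₂ (Ici 0)) (hv' : Continuous v')
    (h0 : v₁ 0 = v₂ 0) (hb : ∀ x > 0, |deriv v₁ x| + |deriv v₂ x| ≤ b)
    (heq : ∀ x > 0, v' x + (deriv (fun z => f (v₁ z)) x - deriv (fun z => f (v₂ z)) x)
      + κ * (deriv (deriv (deriv v₁)) x - deriv (deriv (deriv v₂)) x) = 0)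
    (hr : r ∈ Ioc 0 1) :
    ∫ y in 0..(r ^ 2)⁻¹, (1 - Real.exp (-y)) *
      (2 * expTail (r ^ 2)⁻¹ (fun x => cutoff r x * (v₁ (max 0 x) - v₂ (max 0 x))) y *
        expTail (r ^ 2)⁻¹ (fun x => cutoff r x * v' x) y) ≤
      ((κ + A) + 2 * (κ + A) ^ 2 / κ + 7 * A + 1) * (1 + b) *
        tailEnergy (r ^ 2)⁻¹ (fun x => cutoff r x * (v₁ (max 0 x) - v₂ (max 0 x)))
      + b * (A + 7 * κ) ^ 2 * (146 ^ 2 * r) := by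
  obtain ⟨hr0, hr1⟩ := hr
  obtain ⟨p1, p2, p3, cp1, cp2, dp, dp1, dp2, ep1, ep3⟩ := exists_continuous_derivs h₁
  obtain ⟨q1, q2, q3, cq1, cq2, dq, dq1, dq2, eq1, eq3⟩ := exists_continuous_derivs h₂
  have cp : Continuous fun x => v₁ (max 0 x) :=
    h₁.continuousOn.comp_continuous (by fun_prop) fun x => le_max_left 0 x
  have cq : Continuous fun x => v₂ (max 0 x) :=
    h₂.continuousOn.comp_continuous (by fun_prop) fun x => le_max_left 0 x
  obtain ⟨a, a1, ca, ca1, da, ea, ha, ha1⟩ := exists_averaged_deriv hf hf1 hf2 cp cq cp1 cq1 dp dq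
  have hA : 0 ≤ A := (abs_nonneg _).trans (hf1 0)
  have hpq : ∀ x > 0, |p1 x| + |q1 x| ≤ b := fun x hx => by
    rw [ep1 x hx, eq1 x hx]
    exact hb x hx
  have hb0 : 0 ≤ b := le_trans (by positivity) (hb 1 one_pos)
  have hw1 : ∀ x > 0, |p1 x - q1 x| ≤ b := fun x hx => (abs_sub _ _).trans (hpq x hx)
  have hM : 0 < (r ^ 2)⁻¹ := by positivity
  have hrM : r ^ 2 * (r ^ 2)⁻¹ = 1 := mul_inv_cancel₀ (by positivity)
  have hcb : ∀ x ∈ Ioo 0 (r ^ 2)⁻¹, _ := fun x hx => cutoff_bounds hr0 hr1 hx.1 (by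
    have := mul_lt_mul_of_pos_left hx.2 (show 0 < r ^ 2 by positivity)
    rwa [hrM] at this)
  have hfl : ∀ x > 0, deriv (fun z => f (v₁ z)) x - deriv (fun z => f (v₂ z)) x =
      a1 x * (v₁ (max 0 x) - v₂ (max 0 x)) + a x * (p1 x - q1 x) := by
    intro x hx
    have hev : ∀ v : ℝ → ℝ, (fun z => f (v z)) =ᶠ[nhds x] fun z => f (v (max 0 z)) := by
      intro v
      filter_upwards [Ioi_mem_nhds hx] with z hz
      rw [max_eq_right (le_of_lt hz)]
    have hfd : ∀ y, DifferentiableAt ℝ f y := hf.differentiable (by norm_num)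
    rw [(hev v₁).deriv_eq, (hev v₂).deriv_eq]
    have d1 := (hfd (v₁ (max 0 x))).hasDerivAt.comp x (dp x hx)
    have d2 := (hfd (v₂ (max 0 x))).hasDerivAt.comp x (dq x hx)
    have d3 := (da x hx).mul ((dp x hx).sub (dq x hx))
    have d4 : HasDerivAt (fun z => f (v₁ (max 0 z)) - f (v₂ (max 0 z)))
      (deriv (fun z => f (v₁ (max 0 z))) x - deriv (fun z => f (v₂ (max 0 z))) x) x :=
      d1.differentiableAt.hasDerivAt.sub d2.differentiableAt.hasDerivAt
    simp only [ea] at d4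
    exact d4.unique d3
  have key := energy_estimate (M := (r ^ 2)⁻¹) (l := r) (b := b) (A := A)
    (w := fun x => v₁ (max 0 x) - v₂ (max 0 x)) (w1 := fun x => p1 x - q1 x)
    (w2 := fun x => p2 x - q2 x) (w3 := fun x => p3 x - q3 x) (wt := v')
    (s0 := cutoff r) (s1 := cutoff₁ r) (s2 := cutoff₂ r) (s3 := cutoff₃ r)
    (H := fun x => 146 * r * Real.exp (-(r / 2 * x))) hκ hb0 hr0.le hr1 hM.le
    (cp.sub cq) (by fun_prop) (by fun_prop) ca ca1 hv' (continuous_cutoff r)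
    (by unfold cutoff₁; fun_prop) (by unfold cutoff₂; fun_prop) (by unfold cutoff₃; fun_prop)
    (by fun_prop) (fun x y hxy => by dsimp only; gcongr) (fun x => by positivity)
    (fun x hx => (dp x hx.1).sub (dq x hx.1)) (fun x hx => (dp1 x hx.1).sub (dq1 x hx.1))
    (fun x hx => (dp2 x hx.1).sub (dq2 x hx.1)) (fun x hx => da x hx.1)
    (hasDerivAt_cutoff r) (hasDerivAt_cutoff₁ r) (hasDerivAt_cutoff₂ r)
    (by simp [cutoff, hrM]) (by simp [cutoff₁, hrM]) (by simp [cutoff₂, hrM]) (by simp [h0])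
    (fun x hx => by
      rw [← hfl x hx.1, ep3 x hx.1, eq3 x hx.1]
      exact heq x hx.1)
    (fun x hx => abs_le_mul_of_hasDerivAt (cp.sub cq) (fun x hx => (dp x hx).sub (dq x hx))
      hw1 (by simp [h0]) x hx.1)
    (fun x hx => hw1 x hx.1) (fun x _ => ha x)
    (fun x hx => (ha1 x).trans (mul_le_mul_of_nonneg_left (hpq x hx.1) hA))
    (fun x hx => (hcb x hx).1) (fun x hx => (hcb x hx).2.1) (fun x hx => (hcb x hx).2.2) hA
  refine key.trans ?_
  unfold tailEnergy
  gcongr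
  exact integral_sq_exp_le hr0 146

/-- One-sided comparison on a time interval so short that Grönwall's factor is bounded. -/
theorem le_of_short_interval {κ T A : ℝ} (hκ : 0 < κ) (hT : 0 < T) {f : ℝ → ℝ}
    (hf : ContDiff ℝ 2 f) (hf1 : ∀ x, |deriv f x| ≤ A) (hf2 : ∀ x, |deriv (deriv f) x| ≤ A)
    {u₁ u₂ : ℝ → ℝ → ℝ}
    (hreg1 : ContDiffOn ℝ 1 (fun p : ℝ × ℝ => u₁ p.1 p.2) (Icc 0 T ×ˢ Ici 0))
    (hreg2 : ContDiffOn ℝ 1 (fun p : ℝ × ℝ => u₂ p.1 p.2) (Icc 0 T ×ˢ Ici 0))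
    (hx1 : ∀ t ∈ Icc 0 T, ContDiffOn ℝ 3 (u₁ t) (Ici 0))
    (hx2 : ∀ t ∈ Icc 0 T, ContDiffOn ℝ 3 (u₂ t) (Ici 0))
    (heq1 : ∀ t ∈ Icc 0 T, ∀ x ≥ 0, deriv (fun s => u₁ s x) t + deriv (fun z => f (u₁ t z)) x
      + κ * deriv (deriv (deriv (u₁ t))) x = 0)
    (heq2 : ∀ t ∈ Icc 0 T, ∀ x ≥ 0, deriv (fun s => u₂ s x) t + deriv (fun z => f (u₂ t z)) x
      + κ * deriv (deriv (deriv (u₂ t))) x = 0)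
    (hbdry : ∀ t ∈ Icc 0 T, u₁ t 0 = u₂ t 0) {b : ℝ → ℝ} (hb : IntegrableOn b (Icc 0 T))
    (hgrad : ∀ t ∈ Icc 0 T, ∀ x ≥ 0, |deriv (u₁ t) x| + |deriv (u₂ t) x| ≤ b t)
    {α β : ℝ} (hα : 0 ≤ α) (hβ : β ≤ T) (hinit : ∀ x ≥ 0, u₁ α x = u₂ α x)
    (hshort : ∫ t in α..β, ((κ + A) + 2 * (κ + A) ^ 2 / κ + 7 * A + 1) * (1 + b t) ≤ 1 / 2) :
    ∀ t ∈ Icc α β, ∀ x > 0, u₁ t x ≤ u₂ t x := by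
  intro t ht
  have hαβ : α ≤ β := ht.1.trans ht.2
  have hsub : Icc α β ⊆ Icc 0 T := Icc_subset_Icc hα hβ
  have hsub' : Ioo α β ⊆ Ioo 0 T := Ioo_subset_Ioo hα hβ
  have hA : 0 ≤ A := (abs_nonneg _).trans (hf1 0)
  have hb0 : ∀ t ∈ Icc α β, 0 ≤ b t := fun t ht =>
    le_trans (by positivity) (hgrad t (hsub ht) 0 le_rfl)
  have hb' : IntegrableOn b (Icc α β) := hb.mono_set hsub
  obtain ⟨V₁, V₁', cV₁, cV₁', dV₁, eV₁, eV₁'⟩ := exists_continuous_extension_time hT hreg1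
  obtain ⟨V₂, V₂', cV₂, cV₂', dV₂, eV₂, eV₂'⟩ := exists_continuous_extension_time hT hreg2
  have hE : ∀ r ∈ Ioc (0 : ℝ) 1, ∀ t ∈ Icc α β,
      tailEnergy (r ^ 2)⁻¹ (fun x => cutoff r x * (V₁ t x - V₂ t x)) ≤
        2 * ∫ t in α..β, b t * (A + 7 * κ) ^ 2 * (146 ^ 2 * r) := by
    intro r hr
    have hσ := continuous_cutoff r
    have cg : Continuous fun q : ℝ × ℝ => cutoff r q.2 * (V₁ q.1 q.2 - V₂ q.1 q.2) := by fun_prop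
    have cg' : Continuous fun q : ℝ × ℝ => cutoff r q.2 * (V₁' q.1 q.2 - V₂' q.1 q.2) := by
      fun_prop
    have hr0 : 0 < r := hr.1
    refine gronwall_integrable
      (E := fun t => tailEnergy (r ^ 2)⁻¹ (fun x => cutoff r x * (V₁ t x - V₂ t x)))
      (k := fun t => ((κ + A) + 2 * (κ + A) ^ 2 / κ + 7 * A + 1) * (1 + b t))
      (continuous_tailEnergy (g := fun t x => cutoff r x * (V₁ t x - V₂ t x)) cg _).continuousOn
      (fun t ht => hasDerivAt_tailEnergy (g := fun t x => cutoff r x * (V₁ t x - V₂ t x))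
        (g' := fun t x => cutoff r x * (V₁' t x - V₂' t x)) cg cg'
        (Ioo_mem_nhds ht.1 ht.2) (fun t ht x =>
          ((dV₁ t (hsub' ht) x).sub (dV₂ t (hsub' ht) x)).const_mul _) _)
      (((integrableOn_const (by simp)).add hb').const_mul _)
      ((hb'.mul_const _).mul_const _) (fun t ht => ?_) (fun t ht => ?_) (fun t ht => ?_) ?_ hshort
    · have := hb0 t ht
      positivity
    · have := hb0 t ht
      positivity
    · have ht0 := hsub' ht
      have htc := Ioo_subset_Icc_self ht0
      have := deriv_tailEnergy_le hf hκ hf1 hf2 (hx1 t htc) (hx2 t htc)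
        (v' := fun x => V₁' t x - V₂' t x)
        ((cV₁'.comp (Continuous.prodMk_right t)).sub (cV₂'.comp (Continuous.prodMk_right t)))
        (hbdry t htc) (fun x hx => hgrad t htc x (le_of_lt hx)) (fun x hx => by
          rw [eV₁' t ht0 x (le_of_lt hx), eV₂' t ht0 x (le_of_lt hx)]
          linarith [heq1 t htc x (le_of_lt hx), heq2 t htc x (le_of_lt hx)]) hr
      simpa only [eV₁ t htc, eV₂ t htc] using this
    · have hαm : α ∈ Icc 0 T := hsub (left_mem_Icc.2 hαβ)
      have : ∀ x, V₁ α x - V₂ α x = 0 := fun x => by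
        rw [eV₁ α hαm, eV₂ α hαm, hinit _ (le_max_left _ _), sub_self]
      simp [tailEnergy, expTail, this]
  have htT := hsub ht
  have hint : 0 ≤ ∫ t in α..β, b t := intervalIntegral.integral_nonneg hαβ hb0
  have h := nonpos_of_tailEnergy_le (u := fun x => u₁ t x - u₂ t x)
    (w := fun _ x => V₁ t x - V₂ t x)
    (K := 2 * ((∫ t in α..β, b t) * (A + 7 * κ) ^ 2 * 146 ^ 2))
    ((hx1 t htT).continuousOn.sub (hx2 t htT).continuousOn)
    (fun _ _ => (cV₁.comp (Continuous.prodMk_right t)).sub (cV₂.comp (Continuous.prodMk_right t)))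
    (fun r _ x hx => by rw [eV₁ t htT, eV₂ t htT, max_eq_right hx.1]) (by positivity)
    (fun r hr => by
      refine (hE r hr t ht).trans_eq ?_
      simp only [intervalIntegral.integral_mul_const]
      ring)
  exact fun x hx => sub_nonpos.1 (h x hx)

theorem stmt15 (ε T : ℝ) (hε : 0 < ε) (hT : 0 < T)
    (f : ℝ → ℝ) (hf : ContDiff ℝ 3 f) (Mf : ℝ)
    (hMf : ∀ x, |deriv f x| ≤ Mf ∧ |deriv (deriv f) x| ≤ Mf ∧
      |deriv (deriv (deriv f)) x| ≤ Mf)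
    (u₁ u₂ : ℝ → ℝ → ℝ)
    (hreg1 : ContDiffOn ℝ 1 (fun p : ℝ × ℝ => u₁ p.1 p.2) (Set.Icc 0 T ×ˢ Set.Ici 0))
    (hreg2 : ContDiffOn ℝ 1 (fun p : ℝ × ℝ => u₂ p.1 p.2) (Set.Icc 0 T ×ˢ Set.Ici 0))
    (hx1 : ∀ t ∈ Set.Icc (0:ℝ) T, ContDiffOn ℝ 3 (u₁ t) (Set.Ici 0))
    (hx2 : ∀ t ∈ Set.Icc (0:ℝ) T, ContDiffOn ℝ 3 (u₂ t) (Set.Ici 0))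
    (heq1 : ∀ t ∈ Set.Icc (0:ℝ) T, ∀ x ≥ (0:ℝ),
      deriv (fun s => u₁ s x) t + deriv (fun z => f (u₁ t z)) x
        + ε ^ 2 * deriv (deriv (deriv (u₁ t))) x = 0)
    (heq2 : ∀ t ∈ Set.Icc (0:ℝ) T, ∀ x ≥ (0:ℝ),
      deriv (fun s => u₂ s x) t + deriv (fun z => f (u₂ t z)) x
        + ε ^ 2 * deriv (deriv (deriv (u₂ t))) x = 0)
    (hinit : ∀ x ≥ (0:ℝ), u₁ 0 x = u₂ 0 x)
    (hbdry : ∀ t ∈ Set.Icc (0:ℝ) T, u₁ t 0 = u₂ t 0)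
    (b : ℝ → ℝ) (hb : MeasureTheory.IntegrableOn b (Set.Icc 0 T))
    (hgrad : ∀ t ∈ Set.Icc (0:ℝ) T, ∀ x ≥ (0:ℝ),
      |deriv (u₁ t) x| + |deriv (u₂ t) x| ≤ b t)
    (hH2 : ∀ᵐ t ∂(MeasureTheory.volume.restrict (Set.Icc (0:ℝ) T)),
      MeasureTheory.IntegrableOn (fun x => (u₁ t x - u₂ t x) ^ 2) (Set.Ioi 0) ∧
      MeasureTheory.IntegrableOn
        (fun x => (deriv (u₁ t) x - deriv (u₂ t) x) ^ 2) (Set.Ioi 0) ∧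
      MeasureTheory.IntegrableOn
        (fun x => (deriv (deriv (u₁ t)) x - deriv (deriv (u₂ t)) x) ^ 2) (Set.Ioi 0)) :
    ∀ t ∈ Set.Icc (0:ℝ) T, ∀ x ≥ (0:ℝ), u₁ t x = u₂ t x := by
  have hκ : 0 < ε ^ 2 := by positivity
  have hf2 : ContDiff ℝ 2 f := hf.of_le (by norm_num)
  have hM1 := fun x => (hMf x).1
  have hM2 := fun x => (hMf x).2.1
  obtain ⟨V₁, -, cV₁, -, -, eV₁, -⟩ := exists_continuous_extension_time hT hreg1
  obtain ⟨V₂, -, cV₂, -, -, eV₂, -⟩ := exists_continuous_extension_time hT hreg2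
  have hclosed : IsClosed ({t | ∀ x ≥ (0 : ℝ), u₁ t x = u₂ t x} ∩ Icc 0 T) := by
    have e : {t | ∀ x ≥ (0 : ℝ), u₁ t x = u₂ t x} ∩ Icc 0 T =
        {t | ∀ x ≥ (0 : ℝ), V₁ t x = V₂ t x} ∩ Icc 0 T := by
      ext t
      refine and_congr_left fun ht => forall₂_congr fun x hx => ?_
      rw [eV₁ t ht, eV₂ t ht, max_eq_right hx]
    rw [e]
    refine IsClosed.inter ?_ isClosed_Icc
    simp only [ofPred_forall]
    exact isClosed_iInter fun x => isClosed_iInter fun _ =>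
      isClosed_eq (cV₁.comp (Continuous.prodMk_left x)) (cV₂.comp (Continuous.prodMk_left x))
  refine hclosed.Icc_subset_of_forall_exists_gt hinit ?_
  rintro α ⟨hα, hα0, hαT⟩ y hy
  set c := (ε ^ 2 + Mf) + 2 * (ε ^ 2 + Mf) ^ 2 / ε ^ 2 + 7 * Mf + 1
  have hint : IntegrableOn (fun t => c * (1 + b t)) (uIcc α T) := by
    rw [uIcc_of_le hαT.le]
    exact ((integrableOn_const (by simp)).add
      (hb.mono_set (Icc_subset_Icc_left hα0))).const_mul _
  have hcont := intervalIntegral.continuousOn_primitive_interval hint α left_mem_uIcc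
  rw [uIcc_of_le hαT.le] at hcont
  have hlt : ∀ᶠ s in nhdsWithin α (Icc α T), ∫ t in α..s, c * (1 + b t) < 1 / 2 :=
    hcont.eventually (gt_mem_nhds (by simp))
  have hlt' : ∀ᶠ s in nhdsWithin α (Ioi α), ∫ t in α..s, c * (1 + b t) < 1 / 2 :=
    (nhdsWithin_le_of_mem (Icc_mem_nhdsGT hαT)) hlt
  obtain ⟨β, hβs, hβ⟩ := (hlt'.and (Ioc_mem_nhdsGT (lt_min hy hαT))).exists
  have hβT : β ≤ T := hβ.2.trans (min_le_right _ _)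
  have hβm : β ∈ Icc α β := ⟨hβ.1.le, le_rfl⟩
  refine ⟨β, fun x hx => ?_, hβ.1, hβ.2.trans (min_le_left _ _)⟩
  rcases hx.eq_or_lt with h | h
  · rw [← h]
    exact hbdry β ⟨hα0.trans hβ.1.le, hβT⟩
  · exact le_antisymm
      (le_of_short_interval hκ hT hf2 hM1 hM2 hreg1 hreg2 hx1 hx2 heq1 heq2 hbdry hb hgrad hα0
        hβT hα hβs.le β hβm x h)
      (le_of_short_interval hκ hT hf2 hM1 hM2 hreg2 hreg1 hx2 hx1 heq2 heq1
        (fun t ht => (hbdry t ht).symm) hb (fun t ht x hx => by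
          rw [add_comm]
          exact hgrad t ht x hx) hα0 hβT (fun x hx => (hα x hx).symm) hβs.le β hβm x h)
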